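/- arXiv:1011.5566 — 6 statements merged into one kernel-verified Lean document; each statement's English description precedes it below -/
import Mathlib

section
/- Let C be a k-dimensional linear code in F_q^n with generator matrix G, let X ⊆ {1,…,n} and f ∉ X. If there exists a vector u ∈ F_q^n with supp(u) ⊆ X such that u + e_f ∈ C, then the coordinate x_f is determined by the syndrome G xᵀ together with the coordinates of x on X: for all x, x' ∈ F_q^n, if G xᵀ = G x'ᵀ and x_i = x'_i for every i ∈ X, then x_f = x'_f. -/
/-- If `x` and `x'` have the same image under `G`, then they have the same dot product with
every vector in the row space of `G`. -/
theorem Matrix.dotProduct_eq_of_mem_span_rows {R m n : Type*} [CommSemiring R] [Fintype n]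
    {G : Matrix m n R} {x x' : n → R} (h : G.mulVec x = G.mulVec x')
    {v : n → R} (hv : v ∈ Submodule.span R (Set.range fun i => G i)) :
    dotProduct v x = dotProduct v x' := by
  induction hv using Submodule.span_induction with
  | mem v hv =>
    obtain ⟨i, rfl⟩ := hv
    exact congrFun h i
  | zero => simp
  | add v w _ _ ihv ihw => rw [add_dotProduct, add_dotProduct, ihv, ihw]
  | smul a v _ ih => rw [smul_dotProduct, smul_dotProduct, ih]

/-- **Lemma 1 (sufficiency).** If there is a vector `u` supported on the side-information
set `X` with `u + e_f ∈ C`, then the coordinate `x f` is determined by the broadcast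
`G *ᵥ x` together with the coordinates of `x` on `X`. -/
theorem index_coding_decode_of_exists
    {F : Type*} [Field F] [Fintype F] {n k : ℕ}
    (C : Submodule F (Fin n → F)) (G : Matrix (Fin k) (Fin n) F)
    (hindep : LinearIndependent F (fun i : Fin k => G i))
    (hspan : Submodule.span F (Set.range (fun i : Fin k => G i)) = C)
    (X : Set (Fin n)) (f : Fin n) (hf : f ∉ X)
    (u : Fin n → F) (hu : ∀ i, u i ≠ 0 → i ∈ X)
    (huC : u + Pi.single f 1 ∈ C) :
    ∀ x x' : Fin n → F, G.mulVec x = G.mulVec x' →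
      (∀ i ∈ X, x i = x' i) → x f = x' f := by
  intro x x' hG hX
  have hdot := Matrix.dotProduct_eq_of_mem_span_rows hG (hspan ▸ huC)
  have hux : dotProduct u x = dotProduct u x' := by
    refine Finset.sum_congr rfl fun i _ => ?_
    by_cases hi : u i = 0
    · simp [hi]
    · rw [hX i (hu i hi)]
  rw [add_dotProduct, add_dotProduct, hux] at hdot
  simpa using hdot
end

section
/- Let C be a k-dimensional linear code in F_q^n with generator matrix G, and let X_A, B, E be pairwise disjoint sets with X_A ∪ B ∪ E = {1,…,n} and B, E nonempty. Suppose that for every u ∈ F_q^n with supp(u) ⊆ X_A and every family of scalars (α_i)_{i∈B} in F_q not all zero, the vector u + Σ_{i∈B} α_i e_i does not lie in C. Then for every vector w ∈ F_q^{|B|}, the linear system G_E yᵀ = G_B wᵀ has at least one solution y ∈ F_q^{|E|}. -/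
/-- Fredholm alternative: `A y = b` is solvable if every `v` in the left kernel of `A` is
orthogonal to `b`. -/
theorem Matrix.exists_mulVec_eq_of_forall_vecMul_eq_zero {K m n : Type*} [Field K] [Fintype m]
    [Fintype n] (A : Matrix m n K) (b : m → K)
    (h : ∀ v : m → K, Matrix.vecMul v A = 0 → dotProduct v b = 0) :
    ∃ y : n → K, A.mulVec y = b := by
  classical
  by_contra hb
  have hb' : b ∉ LinearMap.range A.mulVecLin := fun ⟨y, hy⟩ => hb ⟨y, hy⟩
  obtain ⟨f, hfb, hf⟩ := Submodule.exists_le_ker_of_notMem hb'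
  obtain ⟨v, rfl⟩ := (dotProductEquiv K m).surjective f
  refine hfb (h v (dotProduct_eq_zero _ fun y => ?_))
  rw [← Matrix.dotProduct_mulVec]
  exact hf ⟨y, rfl⟩

/-- **Lemma 2, part 2.** Under the security condition, the linear system
`G_E yᵀ = G_B wᵀ` has at least one solution `y` for every `w`. -/
theorem index_coding_system_solvable
    {F : Type*} [Field F] [Fintype F] {n k : ℕ}
    (C : Submodule F (Fin n → F)) (G : Matrix (Fin k) (Fin n) F)
    (hindep : LinearIndependent F (fun i : Fin k => G i))
    (hspan : Submodule.span F (Set.range (fun i : Fin k => G i)) = C)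
    (XA B E : Finset (Fin n))
    (hAB : Disjoint XA B) (hAE : Disjoint XA E) (hBE : Disjoint B E)
    (hcover : XA ∪ B ∪ E = Finset.univ)
    (hB : B.Nonempty) (hE : E.Nonempty)
    (hsec : ∀ u α : Fin n → F, (∀ i, u i ≠ 0 → i ∈ XA) →
      (∀ i, α i ≠ 0 → i ∈ B) → α ≠ 0 → u + α ∉ C) :
    ∀ w : ↥B → F, ∃ y : ↥E → F,
      (G.submatrix id (fun j : ↥E => (j : Fin n))).mulVec y =
        (G.submatrix id (fun i : ↥B => (i : Fin n))).mulVec w := by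
  intro w
  apply Matrix.exists_mulVec_eq_of_forall_vecMul_eq_zero
  intro v hv
  set c : Fin n → F := Matrix.vecMul v G with hc
  have hcC : c ∈ C := by
    rw [← hspan, hc, Matrix.vecMul_eq_sum]
    exact Submodule.sum_mem _ fun i _ =>
      Submodule.smul_mem _ _ (Submodule.subset_span ⟨i, rfl⟩)
  have hcE : ∀ j ∈ E, c j = 0 := fun j hj => congrFun hv ⟨j, hj⟩
  have hcB : ∀ i ∈ B, c i = 0 := by
    by_contra! hne
    obtain ⟨i, hi, hci⟩ := hne
    refine hsec (fun j => if j ∈ B then 0 else c j) (fun j => if j ∈ B then c j else 0)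
      (fun j hj => ?_) (fun j hj => ?_) (fun h => hci ?_) ?_
    · have hj' : j ∈ XA ∪ B ∪ E := hcover ▸ Finset.mem_univ j
      grind
    · grind
    · simpa [hi] using congrFun h i
    · convert hcC using 1
      ext j
      by_cases hj : j ∈ B <;> simp [hj]
  rw [Matrix.dotProduct_mulVec]
  have hvB : Matrix.vecMul v (G.submatrix id (fun i : ↥B => (i : Fin n))) = 0 :=
    funext fun i => hcB i i.2
  rw [hvB, zero_dotProduct]
end

section
/- Let C be a k-dimensional linear code in F_q^n with generator matrix G, and let X_A, B, E be pairwise disjoint sets with X_A ∪ B ∪ E = {1,…,n} and B, E nonempty. Suppose that for every u ∈ F_q^n with supp(u) ⊆ X_A and every family of scalars (α_i)_{i∈B} in F_q not all zero, the vector u + Σ_{i∈B} α_i e_i does not lie in C. Then for every x ∈ F_q^n and every assignment g : B → F_q, there exists z ∈ F_q^n with G zᵀ = G xᵀ, z_i = x_i for all i ∈ X_A, and z_i = g(i) for all i ∈ B. -/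
/-- **Lemma 3 (forward direction, existence step).** Under the security condition,
for every message vector `x` and every assignment `g` on `B` there is a vector `z`
producing the same broadcast, agreeing with `x` on `X_A`, and equal to `g` on `B`. -/
theorem index_coding_exists_consistent_completion
    {F : Type*} [Field F] [Fintype F] {n k : ℕ}
    (C : Submodule F (Fin n → F)) (G : Matrix (Fin k) (Fin n) F)
    (hindep : LinearIndependent F (fun i : Fin k => G i))
    (hspan : Submodule.span F (Set.range (fun i : Fin k => G i)) = C)
    (XA B E : Finset (Fin n))
    (hAB : Disjoint XA B) (hAE : Disjoint XA E) (hBE : Disjoint B E)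
    (hcover : XA ∪ B ∪ E = Finset.univ)
    (hB : B.Nonempty) (hE : E.Nonempty)
    (hsec : ∀ u α : Fin n → F, (∀ i, u i ≠ 0 → i ∈ XA) →
      (∀ i, α i ≠ 0 → i ∈ B) → α ≠ 0 → u + α ∉ C) :
    ∀ x g : Fin n → F, ∃ z : Fin n → F,
      G.mulVec z = G.mulVec x ∧ (∀ i ∈ XA, z i = x i) ∧ (∀ i ∈ B, z i = g i) := by
  intro x g
  let f : (Fin n → F) →ₗ[F] (Fin k → F) × (Fin n → F) :=
    G.mulVecLin.prod (LinearMap.pi fun i => if i ∈ XA ∪ B then LinearMap.proj i else 0)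
  have hf (w : Fin n → F) : f w = (G.mulVec w, fun i => if i ∈ XA ∪ B then w i else 0) := by
    refine Prod.ext rfl (funext fun i => ?_)
    change (if i ∈ XA ∪ B then LinearMap.proj i else 0 : (Fin n → F) →ₗ[F] F) w = _
    change _ = if i ∈ XA ∪ B then w i else 0
    split_ifs <;> rfl
  let t : Fin n → F := fun i => if i ∈ B then g i - x i else 0
  have ht : ((0, t) : (Fin k → F) × (Fin n → F)) ∈ LinearMap.range f := by
    by_contra hmem
    obtain ⟨φ, hφt, hφ⟩ := Submodule.exists_le_ker_of_notMem hmem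
    obtain ⟨c, hc⟩ := (dotProductEquiv F (Fin k)).surjective (φ ∘ₗ LinearMap.inl F _ _)
    obtain ⟨d, hd⟩ := (dotProductEquiv F (Fin n)).surjective (φ ∘ₗ LinearMap.inr F _ _)
    have hc' (a : Fin k → F) : φ (a, 0) = c ⬝ᵥ a := (LinearMap.congr_fun hc a).symm
    have hd' (b : Fin n → F) : φ (0, b) = d ⬝ᵥ b := (LinearMap.congr_fun hd b).symm
    have hker (w : Fin n → F) :
        c ⬝ᵥ G.mulVec w + d ⬝ᵥ (fun i => if i ∈ XA ∪ B then w i else 0) = 0 := by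
      have h : φ (f w) = 0 := hφ ⟨w, rfl⟩
      rwa [hf, ← Prod.fst_add_snd (_, _), map_add, hc', hd'] at h
    let u : Fin n → F := fun i => if i ∈ XA then d i else 0
    let α : Fin n → F := fun i => if i ∈ B then d i else 0
    have hsum : u + α = -Matrix.vecMul c G := by
      rw [eq_neg_iff_add_eq_zero]
      refine dotProduct_eq_zero _ fun w => ?_
      rw [add_dotProduct, ← Matrix.dotProduct_mulVec, add_comm, ← hker w]
      congr 1
      refine Finset.sum_congr rfl fun i _ => ?_
      have : i ∈ XA → i ∉ B := fun h => Finset.disjoint_left.mp hAB h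
      by_cases h1 : i ∈ XA <;> by_cases h2 : i ∈ B <;> simp_all [u, α]
    have hmemC : u + α ∈ C := by
      rw [hsum, ← hspan, Matrix.vecMul_eq_sum]
      exact neg_mem (Submodule.sum_mem _ fun j _ =>
        Submodule.smul_mem _ _ (Submodule.subset_span ⟨j, rfl⟩))
    have hα : α = 0 := by
      by_contra h
      exact hsec u α (fun i hi => by by_contra h'; simp [u, h'] at hi)
        (fun i hi => by by_contra h'; simp [α, h'] at hi) h hmemC
    refine hφt ?_
    rw [hd']
    refine Finset.sum_eq_zero fun i _ => ?_
    have hi : (if i ∈ B then d i else 0) = 0 := congr_fun hα i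
    by_cases h : i ∈ B
    · rw [if_pos h] at hi
      rw [hi, zero_mul]
    · simp [t, h]
  obtain ⟨w, hw⟩ := ht
  rw [hf, Prod.mk.injEq] at hw
  refine ⟨x + w, by rw [Matrix.mulVec_add, hw.1, add_zero], fun i hi => ?_, fun i hi => ?_⟩
  · have := congr_fun hw.2 i
    have hiB := Finset.disjoint_left.mp hAB hi
    simp_all [t]
  · have := congr_fun hw.2 i
    simp_all [t]
end

section
/- Let C be a k-dimensional linear code in F_q^n with minimum distance d and generator matrix G. Let X_A ⊆ {1,…,n} with |X_A| = t ≤ d − 1. Then for every x ∈ F_q^n, the number of vectors z ∈ F_q^n satisfying z_i = x_i for all i ∈ X_A and G zᵀ = G xᵀ is exactly q^{n − t − k}. Hence an adversary of strength t ≤ d − 1 who observes G xᵀ and knows x_i for i ∈ X_A can narrow the message vector x down to a list of exactly q^{n−t−k} candidates. -/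
/-- The nonempty fibres of a linear map on a finite-dimensional space over a finite field have
cardinality a power of the field size, with exponent the dimension of the kernel. -/
theorem Matrix.card_mulVec_fiber {F m n : Type*} [Field F] [Fintype F] [Fintype m] [Fintype n]
    (M : Matrix m n F) (x : n → F) :
    Nat.card {z : n → F // M.mulVec z = M.mulVec x} =
      Fintype.card F ^ (Fintype.card n - M.rank) := by
  have e : {z : n → F // M.mulVec z = M.mulVec x} ≃ LinearMap.ker M.mulVecLin :=
    (Equiv.subRight x).subtypeEquiv fun z => by
      simp [LinearMap.mem_ker, Matrix.mulVec_sub, sub_eq_zero]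
  have hrank : M.rank + Module.finrank F (LinearMap.ker M.mulVecLin) = Fintype.card n := by
    simpa [Matrix.rank] using M.mulVecLin.finrank_range_add_finrank_ker
  rw [Nat.card_congr e, Module.natCard_eq_pow_finrank (K := F), Nat.card_eq_fintype_card]
  congr 1
  omega

/-- Coordinate vectors supported on a set smaller than every nonzero weight of the row space of
`G` are linearly independent together with the rows of `G`. -/
theorem linearIndependent_fromRows_single {F : Type*} [Field F] [DecidableEq F]
    {m n : Type*} [Fintype n] [DecidableEq n] (G : Matrix m n F) (s : Finset n)
    (hG : LinearIndependent F G.row)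
    (hs : ∀ c ∈ Submodule.span F (Set.range G.row), c ≠ 0 → s.card < hammingNorm c) :
    LinearIndependent F
      (Matrix.fromRows (Matrix.of fun i : s => (Pi.single (i : n) 1 : n → F)) G).row := by
  have hsingle : LinearIndependent F (fun i : s => (Pi.single (i : n) 1 : n → F)) :=
    (Pi.linearIndependent_single_one n F).comp _ Subtype.val_injective
  have hsupp : Submodule.span F (Set.range fun i : s => (Pi.single (i : n) 1 : n → F)) ≤
      Submodule.pi ((s : Set n)ᶜ) fun _ => (⊥ : Submodule F F) := by
    rw [Submodule.span_le]
    rintro _ ⟨i, rfl⟩ j hj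
    have hne : j ≠ i := fun h => hj (h ▸ i.2)
    simp [hne]
  have hdisj : Disjoint (Submodule.span F (Set.range fun i : s => (Pi.single (i : n) 1 : n → F)))
      (Submodule.span F (Set.range G.row)) := by
    rw [Submodule.disjoint_def]
    intro c hc hcG
    by_contra hne
    refine (hs c hcG hne).not_ge (Finset.card_le_card fun j hj => ?_)
    by_contra hjs
    exact (Finset.mem_filter.mp hj).2 (by simpa using hsupp hc j hjs)
  exact (funext (Sum.rec (fun _ => rfl) fun _ => rfl) :
    (Matrix.fromRows (Matrix.of fun i : s => (Pi.single (i : n) 1 : n → F)) G).row =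
      Sum.elim (fun i : s => (Pi.single (i : n) 1 : n → F)) G.row) ▸
    hsingle.sum_type hG hdisj

/-- **Theorem 3, part 3.** If `C` is a `k`-dimensional code with minimum distance `d`
and generator matrix `G`, then an adversary knowing the broadcast `G xᵀ` and `t ≤ d - 1`
coordinates of `x` can narrow `x` down to a list of exactly `q ^ (n - t - k)` candidates. -/
theorem index_coding_candidate_list_size
    {F : Type*} [Field F] [Fintype F] [DecidableEq F] {n k : ℕ}
    (C : Submodule F (Fin n → F)) (G : Matrix (Fin k) (Fin n) F)
    (hindep : LinearIndependent F (fun i : Fin k => G i))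
    (hspan : Submodule.span F (Set.range (fun i : Fin k => G i)) = C)
    (d : ℕ) (hd : IsLeast {w : ℕ | ∃ c ∈ C, c ≠ 0 ∧ hammingNorm c = w} d)
    (XA : Finset (Fin n)) (t : ℕ) (hXA : XA.card = t) (ht : t ≤ d - 1) :
    ∀ x : Fin n → F,
      Nat.card {z : Fin n → F // (∀ i ∈ XA, z i = x i) ∧ G.mulVec z = G.mulVec x} =
        Fintype.card F ^ (n - t - k) := by
  intro x
  have hrows : LinearIndependent F
      (Matrix.fromRows (Matrix.of fun i : XA => (Pi.single (i : Fin n) 1 : Fin n → F)) G).row := by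
    refine linearIndependent_fromRows_single G XA hindep fun c hc hne => ?_
    have hle : d ≤ hammingNorm c := hd.2 ⟨c, hspan ▸ hc, hne, rfl⟩
    have hpos : 0 < hammingNorm c := hammingNorm_pos_iff.mpr hne
    omega
  have hcard := Matrix.card_mulVec_fiber
    (Matrix.fromRows (Matrix.of fun i : XA => (Pi.single (i : Fin n) 1 : Fin n → F)) G) x
  rw [hrows.rank_matrix, Fintype.card_sum, Fintype.card_coe, Fintype.card_fin, Fintype.card_fin,
    hXA, ← Nat.sub_sub] at hcard
  rw [← hcard]
  refine Nat.card_congr (Equiv.subtypeEquivRight fun z => ?_)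
  simp [Matrix.fromRows_mulVec, funext_iff, Matrix.mulVec]
end

section
/- Let C be a k-dimensional linear code in F_q^n with dual distance d⊥ (the minimum distance of the dual code C⊥). Let X_A ⊆ {1,…,n} with |X_A| ≥ n − d⊥ + 1 and X_A ≠ {1,…,n}. Then for every index i ∉ X_A there exists a vector u ∈ F_q^n with supp(u) ⊆ X_A such that u + e_i ∈ C. Consequently, for any generator matrix G of C, every coordinate x_i with i ∉ X_A is determined by G xᵀ and the coordinates of x on X_A: a linear index coding scheme based on C is completely insecure against any adversary of strength at least n − d⊥ + 1. -/
/-- A word orthogonal to `C` that vanishes on `S` is zero, as soon as the complement of `S` is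
smaller than the weight of every nonzero word orthogonal to `C`. -/
theorem eq_zero_of_orthogonal_of_vanish {F : Type*} [Field F] [DecidableEq F] {n d : ℕ}
    (C : Submodule F (Fin n → F))
    (hd : d ∈ lowerBounds {w : ℕ | ∃ u : Fin n → F,
        (∀ c ∈ C, ∑ i, u i * c i = 0) ∧ u ≠ 0 ∧ hammingNorm u = w})
    (S : Finset (Fin n)) (hS : n < S.card + d) (v : Fin n → F)
    (hv : ∀ c ∈ C, ∑ i, v i * c i = 0) (hvS : ∀ j ∈ S, v j = 0) : v = 0 := by
  by_contra hne
  have hle : d ≤ hammingNorm v := hd ⟨v, hv, hne, rfl⟩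
  have hsub : hammingNorm v ≤ Sᶜ.card := by
    refine Finset.card_le_card fun j hj => ?_
    rw [Finset.mem_compl]
    exact fun hjS => (Finset.mem_filter.mp hj).2 (hvS j hjS)
  rw [Finset.card_compl, Fintype.card_fin] at hsub
  have := S.card_le_univ
  rw [Fintype.card_fin] at this
  omega

/-- **Theorem 4.** If `C` has dual distance `d⊥` and the adversary knows at least
`n - d⊥ + 1` coordinates (indexed by `X_A ≠ [n]`), then for every `i ∉ X_A` there is a
vector `u` supported on `X_A` with `u + e_i ∈ C`; consequently, for any generator
matrix `G` of `C`, every coordinate `x i` with `i ∉ X_A` is determined by `G xᵀ` and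
the coordinates of `x` on `X_A`: the scheme is completely insecure against such an
adversary. -/
theorem index_coding_completely_insecure
    {F : Type*} [Field F] [Fintype F] [DecidableEq F] {n k : ℕ}
    (C : Submodule F (Fin n → F)) (hk : Module.finrank F C = k)
    (dperp : ℕ)
    (hd : IsLeast {w : ℕ | ∃ u : Fin n → F,
        (∀ c ∈ C, ∑ i, u i * c i = 0) ∧ u ≠ 0 ∧ hammingNorm u = w} dperp)
    (XA : Finset (Fin n)) (hcard : n - dperp + 1 ≤ XA.card) (hne : XA ≠ Finset.univ) :
    ∀ i ∉ XA,
      (∃ u : Fin n → F, (∀ j, u j ≠ 0 → j ∈ XA) ∧ u + Pi.single i 1 ∈ C) ∧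
      ∀ (m : ℕ) (G : Matrix (Fin m) (Fin n) F),
        LinearIndependent F (fun r : Fin m => G r) →
        Submodule.span F (Set.range (fun r : Fin m => G r)) = C →
        ∀ x x' : Fin n → F, G.mulVec x = G.mulVec x' →
          (∀ ℓ ∈ XA, x ℓ = x' ℓ) → x i = x' i := by
  have hS : n < XA.card + dperp := by omega
  have key := eq_zero_of_orthogonal_of_vanish C hd.2 XA hS
  intro i hi
  constructor
  · let W : Submodule F (Fin n → F) := Submodule.pi (XA : Set (Fin n))ᶜ fun _ => ⊥
    have hW : ∀ u ∈ W, ∀ j, u j ≠ 0 → j ∈ XA := fun u hu j hj => by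
      by_contra hjX
      exact hj (hu j hjX)
    have hmem : Pi.single i 1 ∈ C ⊔ W := by
      by_contra hnot
      obtain ⟨f, hfi, hf⟩ := Submodule.exists_le_ker_of_notMem hnot
      have hdot : ∀ c : Fin n → F, f c = ∑ j, f (Pi.single j 1) * c j := fun c => by
        rw [LinearMap.pi_apply_eq_sum_univ f c]
        refine Finset.sum_congr rfl fun j _ => ?_
        rw [smul_eq_mul, mul_comm]
        congr 2
        ext l
        simp [Pi.single_apply, eq_comm]
      have hzero := key (fun j => f (Pi.single j 1))
        (fun c hc => by rw [← hdot]; exact hf (Submodule.mem_sup_left hc))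
        (fun j hj => hf (Submodule.mem_sup_right fun l hl => by
          have hlj : l ≠ j := fun h => hl (h ▸ hj)
          simp [hlj]))
      exact hfi (congrFun hzero i)
    obtain ⟨c, hc, w, hw, hcw⟩ := Submodule.mem_sup.mp hmem
    refine ⟨-w, hW _ (W.neg_mem hw), ?_⟩
    rw [← hcw]
    simpa using hc
  · intro m G _ hspan x x' hG hx
    have horth : ∀ c ∈ C, ∑ j, (x - x') j * c j = 0 := by
      intro c hc
      rw [← hspan] at hc
      induction hc using Submodule.span_induction with
      | mem c hc =>
        obtain ⟨r, rfl⟩ := hc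
        have hr := congrFun (sub_eq_zero.mpr hG) r
        rw [← Matrix.mulVec_sub] at hr
        simpa [Matrix.mulVec, dotProduct, mul_comm] using hr
      | zero => simp
      | add a b _ _ ha hb =>
        simp only [Pi.add_apply, mul_add, Finset.sum_add_distrib, ha, hb, add_zero]
      | smul t a _ ha =>
        simp only [Pi.smul_apply, smul_eq_mul, mul_left_comm _ t, ← Finset.mul_sum, ha, mul_zero]
    exact sub_eq_zero.mp (congrFun (key (x - x') horth fun j hj => sub_eq_zero.mpr (hx j hj)) i)
end

section
/- Let C be a k-dimensional linear code in F_q^n with generator matrix G, and let X_A and B be disjoint subsets of {1,…,n} with B nonempty. Then the following are equivalent: (i) for every u ∈ F_q^n with supp(u) ⊆ X_A and every family of scalars (α_i)_{i∈B} in F_q not all zero, u + Σ_{i∈B} α_i e_i ∉ C; (ii) for every x ∈ F_q^n, all assignments g : B → F_q yield the same number of vectors z ∈ F_q^n satisfying G zᵀ = G xᵀ, z_i = x_i for all i ∈ X_A, and z_i = g(i) for all i ∈ B (this common number being positive). -/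
/-- A vector outside a subspace `D` of a finite coordinate space is separated from `D` by a
dot product. -/
lemma exists_dotProduct_ne_zero_of_notMem {F ι : Type*} [Field F] [Fintype ι]
    (D : Submodule F (ι → F)) {v : ι → F} (hv : v ∉ D) :
    ∃ w : ι → F, v ⬝ᵥ w ≠ 0 ∧ ∀ d ∈ D, d ⬝ᵥ w = 0 := by
  classical
  obtain ⟨f, hfv, hfD⟩ := Submodule.exists_le_ker_of_notMem hv
  obtain ⟨w, rfl⟩ := (dotProductEquiv F ι).surjective f
  simp only [dotProductEquiv_apply_apply, dotProduct_comm w] at hfv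
  exact ⟨w, hfv, fun d hd => (dotProduct_comm d w).trans (hfD hd)⟩

/-- If no vector of the row space of `G` has the form `u + α` with `u` supported on `A` and
`α ≠ 0` supported on `B`, then every prescription of values on `B` extends to a vector in the
kernel of `G` vanishing on `A`. -/
lemma exists_mulVec_eq_zero_of_add_notMem_span {F κ ι : Type*} [Field F] [Fintype ι]
    (G : Matrix κ ι F) (A B : Finset ι)
    (h : ∀ u α : ι → F, (∀ i, u i ≠ 0 → i ∈ A) → (∀ i, α i ≠ 0 → i ∈ B) → α ≠ 0 →
      u + α ∉ Submodule.span F (Set.range fun i => G i)) (g : ι → F) :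
    ∃ w : ι → F, G.mulVec w = 0 ∧ (∀ i ∈ A, w i = 0) ∧ ∀ i ∈ B, w i = g i := by
  classical
  let W : Submodule F (ι → F) :=
    { carrier := {w | ∃ z, G.mulVec z = 0 ∧ (∀ i ∈ A, z i = 0) ∧ ∀ i ∈ B, z i = w i}
      add_mem' := by
        rintro a b ⟨y, hy, hyA, hyB⟩ ⟨z, hz, hzA, hzB⟩
        refine ⟨y + z, by rw [Matrix.mulVec_add, hy, hz, add_zero], fun i hi => ?_, fun i hi => ?_⟩
        · simp [hyA i hi, hzA i hi]
        · simp [hyB i hi, hzB i hi]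
      zero_mem' := ⟨0, by simp⟩
      smul_mem' := by
        rintro c a ⟨y, hy, hyA, hyB⟩
        refine ⟨c • y, by rw [Matrix.mulVec_smul, hy, smul_zero], fun i hi => ?_, fun i hi => ?_⟩
        · simp [hyA i hi]
        · simp [hyB i hi] }
  by_contra hg
  obtain ⟨α, hgα, hWα⟩ := exists_dotProduct_ne_zero_of_notMem W (v := g)
    fun ⟨z, hz⟩ => hg ⟨z, hz⟩
  have hαB : ∀ i, α i ≠ 0 → i ∈ B := by
    intro i hi
    by_contra hiB
    refine hi ?_
    have := hWα (Pi.single i 1) ⟨0, by simp, by simp, fun j hj => by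
      rw [Pi.single_eq_of_ne (ne_of_mem_of_not_mem hj hiB), Pi.zero_apply]⟩
    simpa using this
  have hα : α ≠ 0 := by rintro rfl; simp at hgα
  let S : Submodule F (ι → F) := Submodule.span F (Set.range fun i : A => Pi.single (i : ι) 1)
  have hS : ∀ u ∈ S, ∀ i, u i ≠ 0 → i ∈ A := by
    intro u hu
    induction hu using Submodule.span_induction with
    | mem x hx =>
      obtain ⟨j, rfl⟩ := hx
      intro i hi
      by_contra hiA
      exact hi (Pi.single_eq_of_ne (ne_of_mem_of_not_mem j.2 hiA).symm _)
    | zero => simp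
    | add x y _ _ hx hy =>
      intro i hi
      by_contra hiA
      exact hi (by simp [not_not.1 (mt (hx i) hiA), not_not.1 (mt (hy i) hiA)])
    | smul c x _ hx => exact fun i hi => hx i (right_ne_zero_of_mul hi)
  have hαD : α ∉ Submodule.span F (Set.range fun i => G i) ⊔ S := by
    rw [Submodule.mem_sup]
    rintro ⟨c, hc, s, hs, hcs⟩
    refine h (-s) α (hS _ (S.neg_mem hs)) hαB hα ?_
    rwa [← hcs, neg_add_eq_sub, add_sub_cancel_right]
  obtain ⟨w, hw, hwD⟩ := exists_dotProduct_ne_zero_of_notMem _ hαD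
  refine hw ?_
  rw [dotProduct_comm]
  refine hWα w ⟨w, funext fun i => ?_, fun i hi => ?_, fun _ _ => rfl⟩
  · exact hwD _ (Submodule.mem_sup_left (Submodule.subset_span ⟨i, rfl⟩))
  · simpa using hwD (Pi.single i 1)
      (Submodule.mem_sup_right (Submodule.subset_span ⟨⟨i, hi⟩, rfl⟩))

/-- A vector in the kernel of `G` is orthogonal to the row space of `G`. -/
lemma dotProduct_eq_zero_of_mem_span_rows {F κ ι : Type*} [Field F] [Fintype ι]
    {G : Matrix κ ι F} {c z : ι → F} (hc : c ∈ Submodule.span F (Set.range fun i => G i))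
    (hz : G.mulVec z = 0) : c ⬝ᵥ z = 0 := by
  induction hc using Submodule.span_induction with
  | mem x hx =>
    obtain ⟨j, rfl⟩ := hx
    exact congrFun hz j
  | zero => simp
  | add x y _ _ hx hy => rw [add_dotProduct, hx, hy, add_zero]
  | smul a x _ hx => rw [smul_dotProduct, hx, smul_zero]

/-- **Lemma 3 (both directions, counting form).** The adversary knowing `G xᵀ` and the
coordinates of `x` on `X_A` has no information about the block of coordinates indexed
by `B` (i.e. every assignment `g` on `B` is consistent with the same, positive, number
of message vectors) if and only if no vector `u + ∑_{i ∈ B} α_i e_i` with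
`supp u ⊆ X_A` and the `α_i` not all zero lies in `C`. -/
theorem index_coding_block_security_iff
    {F : Type*} [Field F] [Fintype F] {n k : ℕ}
    (C : Submodule F (Fin n → F)) (G : Matrix (Fin k) (Fin n) F)
    (hindep : LinearIndependent F (fun i : Fin k => G i))
    (hspan : Submodule.span F (Set.range (fun i : Fin k => G i)) = C)
    (XA B : Finset (Fin n)) (hAB : Disjoint XA B) (hB : B.Nonempty) :
    (∀ u α : Fin n → F, (∀ i, u i ≠ 0 → i ∈ XA) →
        (∀ i, α i ≠ 0 → i ∈ B) → α ≠ 0 → u + α ∉ C) ↔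
    (∀ x : Fin n → F, ∃ N : ℕ, 0 < N ∧ ∀ g : Fin n → F,
        Nat.card {z : Fin n → F //
          G.mulVec z = G.mulVec x ∧ (∀ i ∈ XA, z i = x i) ∧ (∀ i ∈ B, z i = g i)} = N) := by
  classical
  subst hspan
  constructor
  · intro h x
    refine ⟨Nat.card {z : Fin n → F //
      G.mulVec z = G.mulVec x ∧ (∀ i ∈ XA, z i = x i) ∧ (∀ i ∈ B, z i = x i)}, ?_, fun g => ?_⟩
    · have : Nonempty {z : Fin n → F //
          G.mulVec z = G.mulVec x ∧ (∀ i ∈ XA, z i = x i) ∧ (∀ i ∈ B, z i = x i)} :=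
        ⟨⟨x, rfl, fun _ _ => rfl, fun _ _ => rfl⟩⟩
      exact Nat.card_pos
    · obtain ⟨w, hw, hwA, hwB⟩ := exists_mulVec_eq_zero_of_add_notMem_span G XA B h (x - g)
      refine Nat.card_congr ((Equiv.addRight w).subtypeEquiv fun z => ?_)
      simp only [Equiv.coe_addRight, Matrix.mulVec_add, hw, add_zero, Pi.add_apply]
      refine and_congr Iff.rfl (and_congr (forall₂_congr fun i hi => ?_)
        (forall₂_congr fun i hi => ?_))
      · rw [hwA i hi, add_zero]
      · rw [hwB i hi, Pi.sub_apply, add_sub, sub_eq_iff_eq_add, add_comm (x i), add_left_inj]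
  · intro h u α hu hα hα0 hmem
    obtain ⟨j, hj⟩ := Function.ne_iff.1 hα0
    obtain ⟨N, hN, hcard⟩ := h 0
    obtain ⟨⟨z, hz, hzA, hzB⟩⟩ := (Nat.card_pos_iff.1 (hN.trans_eq (hcard (Pi.single j 1)).symm)).1
    have hcz := dotProduct_eq_zero_of_mem_span_rows hmem (hz.trans (Matrix.mulVec_zero G))
    have huz : u ⬝ᵥ z = 0 := Finset.sum_eq_zero fun i _ => by
      by_cases hi : u i = 0
      · rw [hi, zero_mul]
      · rw [hzA i (hu i hi), Pi.zero_apply, mul_zero]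
    have hαz : α ⬝ᵥ z = α ⬝ᵥ Pi.single j 1 := Finset.sum_congr rfl fun i _ => by
      by_cases hi : α i = 0
      · rw [hi, zero_mul, zero_mul]
      · rw [hzB i (hα i hi)]
    rw [add_dotProduct, huz, zero_add, hαz, dotProduct_single, mul_one] at hcz
    exact hj hcz
end
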